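/- Let f̄ : ℝⁿ → ℝⁿ be globally Lipschitz with flow φ, let β > 0, let μ and μ_T be finite compactly supported nonnegative Borel measures on ℝⁿ, let x_0 ∈ ℝⁿ, and suppose that for every continuously differentiable v : ℝⁿ → ℝ one has ∫_{ℝⁿ} v dμ_T = v(x_0) + ∫_{ℝⁿ} ( ∇v(x)·f̄(x) − β v(x) ) dμ(x). Then the support of μ_T is contained in the closure of the forward orbit { φ(t, x_0) : t ≥ 0 } of x_0. -/

import Mathlib

open MeasureTheory Set

/-- The support of a Borel measure: the smallest closed set whose complement has
measure zero, realized as the intersection of all closed sets with null complement. -/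
def measureSupport {α : Type*} [TopologicalSpace α] [MeasurableSpace α]
    (μ : Measure α) : Set α :=
  ⋂₀ {C : Set α | IsClosed C ∧ μ Cᶜ = 0}

section helpers

variable {n : ℕ}

/-- The forward orbit. -/
def orbAux (φ : ℝ → (Fin n → ℝ) → (Fin n → ℝ)) (x₀ : Fin n → ℝ) : Set (Fin n → ℝ) :=
  {y | ∃ t : ℝ, 0 ≤ t ∧ φ t x₀ = y}

/-- Grönwall: the distance to the orbit grows at most at rate `K` along the flow. -/
lemma infDist_flow_le
    (f : (Fin n → ℝ) → (Fin n → ℝ)) (K : NNReal) (hf : LipschitzWith K f)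
    (φ : ℝ → (Fin n → ℝ) → (Fin n → ℝ))
    (hφ0 : ∀ x, φ 0 x = x)
    (hφ : ∀ x, ∀ t ∈ Ici (0:ℝ), HasDerivWithinAt (fun s => φ s x) (f (φ t x)) (Ici 0) t)
    (x₀ z : Fin n → ℝ) (s : ℝ) (hs : 0 ≤ s) :
    Metric.infDist (φ s z) (orbAux φ x₀) ≤
      Metric.infDist z (orbAux φ x₀) * Real.exp (K * s) := by
  have hne : (orbAux φ x₀).Nonempty := ⟨φ 0 x₀, 0, le_rfl, rfl⟩
  have key : ∀ q ∈ orbAux φ x₀,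
      Metric.infDist (φ s z) (orbAux φ x₀) ≤ dist z q * Real.exp (K * s) := by
    rintro q ⟨t, ht, rfl⟩
    have hmem : φ (s + t) x₀ ∈ orbAux φ x₀ := ⟨s + t, by positivity, rfl⟩
    refine (Metric.infDist_le_dist_of_mem hmem).trans ?_
    have hd : ∀ r ∈ Ici (0:ℝ), HasDerivWithinAt (fun r => φ (r + t) x₀) (f (φ (r + t) x₀))
        (Ici 0) r := by
      intro r hr
      have h1 := hφ x₀ (r + t) (add_nonneg hr ht)
      have h2 : HasDerivWithinAt (fun r : ℝ => r + t) 1 (Ici 0) r :=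
        ((hasDerivAt_id r).add_const t).hasDerivWithinAt
      have := HasDerivWithinAt.scomp (t' := Ici (0:ℝ)) r h1 h2
        (fun a ha => add_nonneg (show (0:ℝ) ≤ a from ha) ht)
      simpa [Function.comp_def] using this
    have := dist_le_of_trajectories_ODE (v := fun _ => f) (K := K) (f := fun r => φ r z)
      (g := fun r => φ (r + t) x₀) (a := 0) (b := s) (δ := dist z (φ t x₀))
      (fun _ => hf)
      (fun r hr => ((hφ z r hr.1).continuousWithinAt).mono (fun a ha => ha.1))
      (fun r hr => (hφ z r hr.1).mono (fun a ha => le_trans hr.1 ha))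
      (fun r hr => ((hd r hr.1).continuousWithinAt).mono (fun a ha => ha.1))
      (fun r hr => (hd r hr.1).mono (fun a ha => le_trans hr.1 ha))
      (by simp [hφ0]) s ⟨hs, le_rfl⟩
    simpa using this
  rw [← div_le_iff₀ (Real.exp_pos _)]
  refine (Metric.le_infDist hne).2 fun {q} hq => ?_
  rw [div_le_iff₀ (Real.exp_pos _)]
  exact key q hq

/-- At points of differentiability, the Lie derivative of the distance is at most `K` times it. -/
lemma fderiv_infDist_le
    (f : (Fin n → ℝ) → (Fin n → ℝ)) (K : NNReal) (hf : LipschitzWith K f)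
    (φ : ℝ → (Fin n → ℝ) → (Fin n → ℝ))
    (hφ0 : ∀ x, φ 0 x = x)
    (hφ : ∀ x, ∀ t ∈ Ici (0:ℝ), HasDerivWithinAt (fun s => φ s x) (f (φ t x)) (Ici 0) t)
    (x₀ z w : Fin n → ℝ)
    (hz : DifferentiableAt ℝ (fun x => Metric.infDist x (orbAux φ x₀)) z) :
    fderiv ℝ (fun x => Metric.infDist x (orbAux φ x₀)) z w ≤
      K * Metric.infDist z (orbAux φ x₀) + ‖w - f z‖ := by
  set d := fun x => Metric.infDist x (orbAux φ x₀) with hd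
  have h1 : fderiv ℝ d z (f z) ≤ K * d z := by
    have hA : HasDerivWithinAt (fun s => d (φ s z)) (fderiv ℝ d z (f z)) (Ici 0) 0 := by
      have h0 := hφ z 0 (mem_Ici.2 le_rfl)
      rw [hφ0] at h0
      have hz' : HasFDerivAt d (fderiv ℝ d z) (φ 0 z) := by rw [hφ0]; exact hz.hasFDerivAt
      exact hz'.comp_hasDerivWithinAt (0:ℝ) h0
    have hB : HasDerivWithinAt (fun s => d z * Real.exp (K * s)) (K * d z) (Ici 0) 0 := by
      have : HasDerivAt (fun s : ℝ => d z * Real.exp (K * s)) (d z * (Real.exp (K * 0) * (K * 1))) 0 :=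
        (((hasDerivAt_id (0:ℝ)).const_mul (K:ℝ)).exp).const_mul (d z)
      have he : d z * (Real.exp (K * 0) * (K * 1)) = K * d z := by
        rw [mul_zero, Real.exp_zero]; ring
      rw [he] at this
      exact this.hasDerivWithinAt
    have hC := hB.sub hA
    have hC' := hC.Ioi_of_Ici
    rw [hasDerivWithinAt_iff_tendsto_slope' (by simp)] at hC'
    have : 0 ≤ K * d z - fderiv ℝ d z (f z) := by
      refine ge_of_tendsto hC' ?_
      filter_upwards [self_mem_nhdsWithin] with s hs
      have hs' : (0:ℝ) < s := hs
      have := infDist_flow_le f K hf φ hφ0 hφ x₀ z s hs'.le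
      simp only [slope_def_field, Pi.sub_apply, hφ0]
      apply div_nonneg
      · simp [hd]; exact this
      · simpa using hs'.le
    linarith
  have h2 : fderiv ℝ d z (w - f z) ≤ ‖w - f z‖ := by
    have hl : LipschitzWith 1 d := Metric.lipschitz_infDist_pt _
    have := norm_fderiv_le_of_lipschitz ℝ hl (x₀ := z)
    calc fderiv ℝ d z (w - f z) ≤ ‖fderiv ℝ d z (w - f z)‖ := Real.le_norm_self _
      _ ≤ ‖fderiv ℝ d z‖ * ‖w - f z‖ := ContinuousLinearMap.le_opNorm _ _
      _ ≤ 1 * ‖w - f z‖ := by gcongr; simpa using this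
      _ = _ := one_mul _
  rw [map_sub] at h2
  linarith

/-- Regularized distance to the orbit. -/
lemma exists_regularized
    (f : (Fin n → ℝ) → (Fin n → ℝ)) (K : NNReal) (hf : LipschitzWith K f)
    (φ : ℝ → (Fin n → ℝ) → (Fin n → ℝ))
    (hφ0 : ∀ x, φ 0 x = x)
    (hφ : ∀ x, ∀ t ∈ Ici (0:ℝ), HasDerivWithinAt (fun s => φ s x) (f (φ t x)) (Ici 0) t)
    (x₀ : Fin n → ℝ) (ε : ℝ) (hε : 0 < ε) :
    ∃ g : (Fin n → ℝ) → ℝ, ContDiff ℝ 1 g ∧ (∀ x, 0 ≤ g x) ∧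
      (∀ x, |g x - Metric.infDist x (orbAux φ x₀)| ≤ ε) ∧
      ∀ x, fderiv ℝ g x (f x) ≤ K * (g x + ε) := by
  set d := fun x => Metric.infDist x (orbAux φ x₀) with hd
  have hl : LipschitzWith 1 d := Metric.lipschitz_infDist_pt _
  have hdc : Continuous d := hl.continuous
  let b : ContDiffBump (0 : Fin n → ℝ) := ⟨ε / 2, ε, by positivity, by linarith⟩
  let ρ := b.normed volume
  have hρc : Continuous ρ := b.continuous_normed
  have hρ0 : ∀ y, 0 ≤ ρ y := fun y => b.nonneg_normed y
  have hρs : HasCompactSupport ρ := b.hasCompactSupport_normed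
  have hρ1 : ∫ y, ρ y = 1 := b.integral_normed
  have hρz : ∀ y, ρ y ≠ 0 → ‖y‖ ≤ ε := by
    intro y hy
    have : y ∈ Function.support ρ := hy
    rw [b.support_normed_eq] at this
    have h2 := mem_ball_zero_iff.1 this
    exact h2.le
  have hρi : Integrable ρ := hρc.integrable_of_hasCompactSupport hρs
  have hint : ∀ h : (Fin n → ℝ) → ℝ, Continuous h → Integrable (fun y => ρ y * h y) := fun h hh =>
    (hρc.mul hh).integrable_of_hasCompactSupport hρs.mul_right
  let g : (Fin n → ℝ) → ℝ := convolution ρ d (ContinuousLinearMap.lsmul ℝ ℝ) volume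
  have hg : ∀ x, g x = ∫ y, ρ y * d (x - y) := fun x => by
    simp [g, convolution_def]
  have hgC : ContDiff ℝ 1 g :=
    hρs.contDiff_convolution_left _ b.contDiff_normed hdc.locallyIntegrable
  refine ⟨g, hgC, ?_, ?_, ?_⟩
  · intro x
    rw [hg]
    exact integral_nonneg fun y => mul_nonneg (hρ0 y) Metric.infDist_nonneg
  · intro x
    have : g x - d x = ∫ y, ρ y * (d (x - y) - d x) := by
      have h1 : d x = ∫ y, ρ y * d x := by rw [integral_mul_const, hρ1, one_mul]
      rw [hg]
      conv_lhs => rw [h1]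
      rw [← integral_sub (hint _ (by fun_prop)) (hint _ (by fun_prop))]
      simp [mul_sub]
    change |g x - d x| ≤ ε
    rw [this]
    calc |∫ y, ρ y * (d (x - y) - d x)| ≤ ∫ y, |ρ y * (d (x - y) - d x)| :=
          abs_integral_le_integral_abs
      _ ≤ ∫ y, ρ y * ε := by
          refine integral_mono (hint _ (by fun_prop)).abs (hint _ (by fun_prop)) fun y => ?_
          simp only [abs_mul, abs_of_nonneg (hρ0 y)]
          by_cases hy : ρ y = 0
          · simp [hy]
          · refine mul_le_mul_of_nonneg_left ?_ (hρ0 y)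
            have := hl.dist_le_mul (x - y) x
            simp [dist_eq_norm] at this
            exact this.trans (hρz y hy)
      _ = ε := by rw [integral_mul_const, hρ1, one_mul]
  · intro x
    set w := f x with hw
    have hae : ∀ᵐ y : Fin n → ℝ, DifferentiableAt ℝ d (x - y) := by
      have h := hl.ae_differentiableAt (μ := (volume : Measure (Fin n → ℝ)))
      exact (Measure.measurePreserving_sub_left volume x).quasiMeasurePreserving.ae h
    have hline : HasDerivAt (fun s : ℝ => g (x + s • w)) (fderiv ℝ g x w) 0 := by
      have h1 : HasFDerivAt g (fderiv ℝ g x) (x + (0:ℝ) • w) := by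
        simpa using (hgC.differentiable one_ne_zero x).hasFDerivAt
      have h2 : HasDerivAt (fun s : ℝ => x + s • w) w 0 := by
        simpa using ((hasDerivAt_id (0:ℝ)).smul_const w).const_add x
      exact h1.comp_hasDerivAt 0 h2
    have hpt : ∀ y, DifferentiableAt ℝ d (x - y) → HasDerivAt (fun s : ℝ => ρ y * d (x + s • w - y))
        (ρ y * fderiv ℝ d (x - y) w) 0 := by
      intro y hy
      have h1 : HasFDerivAt d (fderiv ℝ d (x - y)) (x + (0:ℝ) • w - y) := by
        simpa using hy.hasFDerivAt
      have h2 : HasDerivAt (fun s : ℝ => x + s • w - y) w 0 := by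
        simpa using (((hasDerivAt_id (0:ℝ)).smul_const w).const_add x).sub_const y
      exact (h1.comp_hasDerivAt 0 h2).const_mul _
    have hmeas : AEStronglyMeasurable (fun y => ρ y * fderiv ℝ d (x - y) w) volume := by
      have : Measurable fun z => fderiv ℝ d z w := measurable_fderiv_apply_const ℝ d w
      exact (hρc.measurable.mul (this.comp (measurable_const.sub measurable_id))).aestronglyMeasurable
    have hder := hasDerivAt_integral_of_dominated_loc_of_lip (μ := (volume : Measure (Fin n → ℝ)))
      (F := fun (s : ℝ) y => ρ y * d (x + s • w - y)) (x₀ := 0) (s := univ)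
      (bound := fun y => ρ y * ‖w‖)
      (F' := fun y => ρ y * fderiv ℝ d (x - y) w) Filter.univ_mem
      (Filter.Eventually.of_forall fun s => (hint _ (by fun_prop)).aestronglyMeasurable)
      (hint _ (by fun_prop)) hmeas
      (Filter.Eventually.of_forall fun y => by
        refine LipschitzOnWith.of_dist_le_mul fun s _ t _ => ?_
        have h3 := hl.dist_le_mul (x + s • w - y) (x + t • w - y)
        have h4 : x + s • w - y - (x + t • w - y) = (s - t) • w := by
          rw [sub_smul]; abel
        rw [Real.dist_eq, dist_eq_norm, h4, norm_smul] at h3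
        simp only [NNReal.coe_one, one_mul, Real.norm_eq_abs] at h3
        rw [Real.dist_eq, Real.dist_eq, ← mul_sub, abs_mul, Real.coe_nnabs,
          abs_of_nonneg (hρ0 y), abs_of_nonneg (mul_nonneg (hρ0 y) (norm_nonneg w))]
        calc _ ≤ ρ y * (|s - t| * ‖w‖) := mul_le_mul_of_nonneg_left h3 (hρ0 y)
          _ = _ := by ring)
      (hint _ (by fun_prop))
      (hae.mono hpt)
    have heq : fderiv ℝ g x w = ∫ y, ρ y * fderiv ℝ d (x - y) w := by
      refine hline.unique ?_
      have := hder.2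
      simpa only [← hg] using this
    rw [heq]
    calc ∫ y, ρ y * fderiv ℝ d (x - y) w ≤ ∫ y, (K * (ρ y * d (x - y)) + ρ y * (K * ε)) := by
          refine integral_mono_ae hder.1
            (((hint _ (by fun_prop)).const_mul _).add (hint _ (by fun_prop))) ?_
          filter_upwards [hae] with y hy
          by_cases h0 : ρ y = 0
          · simp [h0]
          · have h5 := fderiv_infDist_le f K hf φ hφ0 hφ x₀ (x - y) w hy
            have h6 : ‖w - f (x - y)‖ ≤ K * ε := by
              have := hf.dist_le_mul x (x - y)
              simp only [dist_eq_norm, sub_sub_cancel] at this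
              exact this.trans (mul_le_mul_of_nonneg_left (hρz y h0) K.2)
            calc ρ y * fderiv ℝ d (x - y) w ≤ ρ y * (K * d (x - y) + K * ε) :=
                  mul_le_mul_of_nonneg_left (h5.trans (by gcongr)) (hρ0 y)
              _ = _ := by ring
      _ = K * (g x + ε) := by
          rw [integral_add ((hint _ (by fun_prop)).const_mul _) (hint _ (by fun_prop)),
            integral_const_mul, integral_mul_const, hρ1, hg]
          ring

lemma integrable_of_cpt (μ : Measure (Fin n → ℝ)) [IsFiniteMeasure μ]
    (hμc : ∃ K' : Set (Fin n → ℝ), IsCompact K' ∧ μ K'ᶜ = 0) (h : (Fin n → ℝ) → ℝ)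
    (hh : Continuous h) : Integrable h μ := by
  obtain ⟨C, hC, h0⟩ := hμc
  have h1 : IntegrableOn h C μ := hh.continuousOn.integrableOn_compact hC
  have h2 : μ.restrict C = μ := Measure.restrict_eq_self_of_ae_mem h0
  rwa [IntegrableOn, h2] at h1

end helpers

/-- Dirac initial measure, arbitrary terminal measure case of the superposition theorem:
if `(δ_{x₀}, μ_T, μ)` solve the discounted Liouville equation, then the support of `μ_T`
is contained in the closure of the forward orbit of `x₀`. -/
theorem liouville_terminal_support_in_orbit {n : ℕ}
    (f : (Fin n → ℝ) → (Fin n → ℝ)) (K : NNReal) (hf : LipschitzWith K f)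
    (φ : ℝ → (Fin n → ℝ) → (Fin n → ℝ))
    (hφ0 : ∀ x, φ 0 x = x)
    (hφ : ∀ x, ∀ t ∈ Ici (0:ℝ), HasDerivWithinAt (fun s => φ s x) (f (φ t x)) (Ici 0) t)
    (β : ℝ) (hβ : 0 < β)
    (μ μT : Measure (Fin n → ℝ)) [IsFiniteMeasure μ] [IsFiniteMeasure μT]
    (hμc : ∃ K' : Set (Fin n → ℝ), IsCompact K' ∧ μ K'ᶜ = 0)
    (hμTc : ∃ K' : Set (Fin n → ℝ), IsCompact K' ∧ μT K'ᶜ = 0)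
    (x₀ : Fin n → ℝ)
    (hLiouville : ∀ v : (Fin n → ℝ) → ℝ, ContDiff ℝ 1 v →
      ∫ x, v x ∂μT = v x₀ + ∫ x, (fderiv ℝ v x (f x) - β * v x) ∂μ) :
    measureSupport μT ⊆ closure {y | ∃ t : ℝ, 0 ≤ t ∧ φ t x₀ = y} := by
  change _ ⊆ closure (orbAux φ x₀)
  set d := fun x => Metric.infDist x (orbAux φ x₀) with hd
  have hdc : Continuous d := Metric.continuous_infDist_pt _
  have hne : (orbAux φ x₀).Nonempty := ⟨φ 0 x₀, 0, le_rfl, rfl⟩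
  have hx₀ : d x₀ = 0 := Metric.infDist_zero_of_mem ⟨0, le_rfl, hφ0 x₀⟩
  set p : ℝ := β / (K + 1) with hp
  have hK : (0:ℝ) < K + 1 := by positivity
  have hp0 : 0 < p := by positivity
  have hpK : p * (K + 1) = β := by rw [hp]; field_simp
  have hdp : Continuous fun x => d x ^ p := hdc.rpow_const fun _ => Or.inr hp0.le
  have hd0 : ∀ x, 0 ≤ d x := fun x => Metric.infDist_nonneg
  have key : ∀ ε : ℝ, 0 < ε → ∫ x, d x ^ p ∂μT ≤ (2 * ε) ^ p := by
    intro ε hε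
    obtain ⟨g, hg, hg0, hgd, hgf⟩ := exists_regularized f K hf φ hφ0 hφ x₀ ε hε
    have hpos : ∀ x, 0 < g x + ε := fun x => add_pos_of_nonneg_of_pos (hg0 x) hε
    have hv : ContDiff ℝ 1 fun x => (g x + ε) ^ p :=
      (hg.add contDiff_const).rpow_const_of_ne fun x => (hpos x).ne'
    have hL := hLiouville _ hv
    have hneg : ∫ x, (fderiv ℝ (fun x => (g x + ε) ^ p) x (f x) - β * (g x + ε) ^ p) ∂μ ≤ 0 := by
      refine integral_nonpos fun x => ?_
      have h1 : HasFDerivAt (fun x => g x + ε) (fderiv ℝ g x) x :=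
        (hg.differentiable one_ne_zero x).hasFDerivAt.add_const ε
      have h2 := h1.rpow_const (p := p) (Or.inl (hpos x).ne')
      simp only [h2.fderiv, Pi.zero_apply, _root_.smul_apply, smul_eq_mul]
      have h3 : (g x + ε) ^ p = (g x + ε) ^ (p - 1) * (g x + ε) := by
        rw [← Real.rpow_add_one (hpos x).ne', sub_add_cancel]
      have h4 : 0 ≤ p * (g x + ε) ^ (p - 1) := by have := hpos x; positivity
      have h5 : fderiv ℝ g x (f x) ≤ (K + 1) * (g x + ε) := by
        have := hgf x
        have := hpos x
        linarith
      have h6 := mul_le_mul_of_nonneg_left h5 h4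
      rw [h3, ← hpK]
      linarith
    calc ∫ x, d x ^ p ∂μT ≤ ∫ x, (g x + ε) ^ p ∂μT := by
          refine integral_mono (integrable_of_cpt μT hμTc _ hdp)
            (integrable_of_cpt μT hμTc _ hv.continuous) fun x => ?_
          refine Real.rpow_le_rpow (hd0 x) ?_ hp0.le
          have := (abs_le.1 (hgd x)).1
          change d x ≤ _
          simp only [hd]; linarith
      _ ≤ (g x₀ + ε) ^ p := by linarith
      _ ≤ (2 * ε) ^ p := by
          refine Real.rpow_le_rpow (hpos x₀).le ?_ hp0.le
          have := (abs_le.1 (hgd x₀)).2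
          simp only [hd] at hx₀
          linarith
  have hle : ∫ x, d x ^ p ∂μT ≤ 0 := by
    have ht : Filter.Tendsto (fun ε : ℝ => (2 * ε) ^ p) (nhdsWithin 0 (Ioi 0)) (nhds 0) := by
      have hc : Continuous fun ε : ℝ => (2 * ε) ^ p :=
        (continuous_const.mul continuous_id).rpow_const fun _ => Or.inr hp0.le
      have := hc.tendsto 0
      simp only [mul_zero, Real.zero_rpow hp0.ne'] at this
      exact this.mono_left nhdsWithin_le_nhds
    refine ge_of_tendsto ht ?_
    filter_upwards [self_mem_nhdsWithin] with ε hε using key ε hε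
  have hnn : ∀ x, 0 ≤ d x ^ p := fun x => Real.rpow_nonneg (hd0 x) p
  have hz : (fun x => d x ^ p) =ᵐ[μT] 0 :=
    (integral_eq_zero_iff_of_nonneg hnn (integrable_of_cpt μT hμTc _ hdp)).1
      (le_antisymm hle (integral_nonneg hnn))
  refine sInter_subset_of_mem ⟨isClosed_closure, ?_⟩
  have : ∀ᵐ x ∂μT, x ∈ closure (orbAux φ x₀) := by
    filter_upwards [hz] with x hx
    rw [Metric.mem_closure_iff_infDist_zero hne]
    exact (Real.rpow_eq_zero (hd0 x) hp0.ne').1 hx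
  exact this
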